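/- arXiv:2601.08710 — 2 statements merged into one kernel-verified Lean document; each statement's English description precedes it below -/
import Mathlib

section
/- Let E be a non-trivial equational theory. If E has unrestricted unification type unitary, then E has restricted unification type unitary; and if E has unrestricted unification type finitary, then E has restricted unification type finitary or unitary. -/
namespace UnifFW

/-- First-order terms over a signature `F` (an arity-indexed family of function
symbols), with variables from the countably infinite set `V = ℕ`. -/
inductive Term (F : ℕ → Type) : Type
  | var : ℕ → Term F
  | app : (n : ℕ) → F n → (Fin n → Term F) → Term F

variable {F : ℕ → Type}

/-- The set of variables occurring in a term. -/
def Term.vars : Term F → Set ℕ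
  | .var x => {x}
  | .app _ _ ts => ⋃ i, (ts i).vars

/-- Homomorphic extension of a map `V → T(Σ,V)` to terms. -/
def Term.subst (σ : ℕ → Term F) : Term F → Term F
  | .var x => σ x
  | .app n f ts => .app n f (fun i => (ts i).subst σ)

/-- The congruence `≈_E` induced by a set `E` of identities: the smallest
equivalence relation containing all substitution instances of identities of `E`
and compatible with the term constructors. -/
inductive EqE (E : Set (Term F × Term F)) : Term F → Term F → Prop
  | ax {s t : Term F} (σ : ℕ → Term F) : (s, t) ∈ E → EqE E (s.subst σ) (t.subst σ)
  | refl (t : Term F) : EqE E t t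
  | symm {s t : Term F} : EqE E s t → EqE E t s
  | trans {s t u : Term F} : EqE E s t → EqE E t u → EqE E s u
  | congr {n : ℕ} (f : F n) {ts us : Fin n → Term F} :
      (∀ i, EqE E (ts i) (us i)) → EqE E (.app n f ts) (.app n f us)

/-- A theory is non-trivial if distinct variables are not equated. -/
def NonTrivial (E : Set (Term F × Term F)) : Prop :=
  ∀ x y : ℕ, x ≠ y → ¬ EqE E (.var x) (.var y)

/-- A theory is regular if both sides of each identity have the same variables. -/
def Regular (E : Set (Term F × Term F)) : Prop :=
  ∀ p ∈ E, (Prod.fst p).vars = (Prod.snd p).vars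

/-- A substitution: a map `V → T(Σ,V)` with finite domain. -/
structure Subst (F : ℕ → Type) where
  toFun : ℕ → Term F
  finite_dom : {x : ℕ | toFun x ≠ Term.var x}.Finite

/-- The domain of a substitution. -/
def Subst.Dom (σ : Subst F) : Set ℕ := {x : ℕ | σ.toFun x ≠ Term.var x}

/-- The variable range of a substitution: all variables occurring in the images
of domain variables. -/
def Subst.VRan (σ : Subst F) : Set ℕ := ⋃ x ∈ σ.Dom, (σ.toFun x).vars

/-- The instantiation preorder `σ ≤_E^X θ`: some substitution `λ` satisfies
`λ(σ(x)) ≈_E θ(x)` for all `x ∈ X`. -/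
def InstLE (E : Set (Term F × Term F)) (X : Set ℕ) (σ θ : Subst F) : Prop :=
  ∃ lam : Subst F, ∀ x ∈ X, EqE E ((σ.toFun x).subst lam.toFun) (θ.toFun x)

/-- The equivalence `σ ∼_E^X θ` induced by the instantiation preorder. -/
def InstEquiv (E : Set (Term F × Term F)) (X : Set ℕ) (σ θ : Subst F) : Prop :=
  InstLE E X σ θ ∧ InstLE E X θ σ

/-- The strict instantiation order `σ <_E^X θ`. -/
def InstLT (E : Set (Term F × Term F)) (X : Set ℕ) (σ θ : Subst F) : Prop :=
  InstLE E X σ θ ∧ ¬ InstLE E X θ σ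

/-- The set of variables occurring in a unification problem. -/
def VarsP (Γ : Set (Term F × Term F)) : Set ℕ :=
  ⋃ p ∈ Γ, (Prod.fst p).vars ∪ (Prod.snd p).vars

/-- `σ` is an `E`-unifier of the unification problem `Γ`. -/
def Unifier (E Γ : Set (Term F × Term F)) (σ : Subst F) : Prop :=
  ∀ p ∈ Γ, EqE E ((Prod.fst p).subst σ.toFun) ((Prod.snd p).subst σ.toFun)

/-- A unification problem is solvable if it has a unifier. -/
def Solvable (E Γ : Set (Term F × Term F)) : Prop := ∃ σ : Subst F, Unifier E Γ σ

/-- `S` is a complete set of `E`-unifiers of `Γ` w.r.t. `≤_E^X`. -/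
def CompleteSet (E Γ : Set (Term F × Term F)) (X : Set ℕ) (S : Set (Subst F)) : Prop :=
  (∀ σ ∈ S, Unifier E Γ σ) ∧ ∀ θ : Subst F, Unifier E Γ θ → ∃ σ ∈ S, InstLE E X σ θ

/-- `S` is a minimal complete set of `E`-unifiers of `Γ` w.r.t. `≤_E^X`:
complete, and no two distinct elements are comparable. -/
def MinimalComplete (E Γ : Set (Term F × Term F)) (X : Set ℕ) (S : Set (Subst F)) : Prop :=
  CompleteSet E Γ X S ∧ ∀ σ ∈ S, ∀ θ ∈ S, σ ≠ θ → ¬ InstLE E X σ θ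

/-- `Γ` has unification type unitary w.r.t. `≤_E^X`. -/
def TypeUnitary (E Γ : Set (Term F × Term F)) (X : Set ℕ) : Prop :=
  ∃ σ : Subst F, MinimalComplete E Γ X {σ}

/-- `Γ` has unification type finitary w.r.t. `≤_E^X`. -/
def TypeFinitary (E Γ : Set (Term F × Term F)) (X : Set ℕ) : Prop :=
  ∃ S : Set (Subst F), MinimalComplete E Γ X S ∧ S.Finite ∧ 1 < S.ncard

/-- `Γ` has unification type infinitary w.r.t. `≤_E^X`. -/
def TypeInfinitary (E Γ : Set (Term F × Term F)) (X : Set ℕ) : Prop :=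
  ∃ S : Set (Subst F), MinimalComplete E Γ X S ∧ S.Infinite

/-- `Γ` has unification type zero w.r.t. `≤_E^X`. -/
def TypeZero (E Γ : Set (Term F × Term F)) (X : Set ℕ) : Prop :=
  ¬ ∃ S : Set (Subst F), MinimalComplete E Γ X S

/-- `σ` is a `≤_E^X`-minimal `E`-unifier of `Γ`. -/
def MinUnifier (E Γ : Set (Term F × Term F)) (X : Set ℕ) (σ : Subst F) : Prop :=
  Unifier E Γ σ ∧ ∀ θ : Subst F, Unifier E Γ θ → InstLE E X θ σ → InstLE E X σ θ

/-- The set `C_E(Γ)` of unifiers all of whose range variables occur in the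
images of at least two distinct variables. -/
def CSet (E Γ : Set (Term F × Term F)) : Set (Subst F) :=
  {σ : Subst F | Unifier E Γ σ ∧
    ∀ y ∈ σ.VRan, ∃ x x' : ℕ, x ≠ x' ∧ y ∈ (σ.toFun x).vars ∩ (σ.toFun x').vars}

/-- `E` is Noetherian w.r.t. the unrestricted instantiation preorder: there is
no infinite strictly descending chain `σ₁ >_E^V σ₂ >_E^V ⋯`. -/
def Noetherian (E : Set (Term F × Term F)) : Prop :=
  ¬ ∃ f : ℕ → Subst F, ∀ n : ℕ, InstLT E Set.univ (f (n + 1)) (f n)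


/-- `E` has unrestricted unification type unitary. -/
def TheoryUnrUnitary {F : ℕ → Type} (E : Set (Term F × Term F)) : Prop :=
  ∀ Γ : Set (Term F × Term F), Γ.Finite → Solvable E Γ → TypeUnitary E Γ Set.univ

/-- `E` has restricted unification type unitary. -/
def TheoryResUnitary {F : ℕ → Type} (E : Set (Term F × Term F)) : Prop :=
  ∀ Γ : Set (Term F × Term F), Γ.Finite → Solvable E Γ → TypeUnitary E Γ (VarsP Γ)

/-- `E` has unrestricted unification type finitary: every solvable problem is
unitary or finitary, and some solvable problem is finitary. -/
def TheoryUnrFinitary {F : ℕ → Type} (E : Set (Term F × Term F)) : Prop :=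
  (∀ Γ : Set (Term F × Term F), Γ.Finite → Solvable E Γ →
    TypeUnitary E Γ Set.univ ∨ TypeFinitary E Γ Set.univ) ∧
  (∃ Γ : Set (Term F × Term F), Γ.Finite ∧ Solvable E Γ ∧ TypeFinitary E Γ Set.univ)

/-- `E` has restricted unification type finitary. -/
def TheoryResFinitary {F : ℕ → Type} (E : Set (Term F × Term F)) : Prop :=
  (∀ Γ : Set (Term F × Term F), Γ.Finite → Solvable E Γ →
    TypeUnitary E Γ (VarsP Γ) ∨ TypeFinitary E Γ (VarsP Γ)) ∧
  (∃ Γ : Set (Term F × Term F), Γ.Finite ∧ Solvable E Γ ∧ TypeFinitary E Γ (VarsP Γ))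

theorem Term.subst_subst (σ τ : ℕ → Term F) (t : Term F) :
    (t.subst σ).subst τ = t.subst (fun x => (σ x).subst τ) := by
  induction t with
  | var x => rfl
  | app n f ts ih => simp only [Term.subst, ih]

theorem EqE.subst {E : Set (Term F × Term F)} {s t : Term F} (τ : ℕ → Term F)
    (h : EqE E s t) : EqE E (s.subst τ) (t.subst τ) := by
  induction h with
  | ax σ h =>
    rw [Term.subst_subst, Term.subst_subst]
    exact .ax _ h
  | refl t => exact .refl _
  | symm _ ih => exact ih.symm
  | trans _ _ ih₁ ih₂ => exact ih₁.trans ih₂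
  | congr f _ ih => exact .congr f ih

/-- The composition of two substitutions, `σ` being applied first. -/
def Subst.comp (τ σ : Subst F) : Subst F where
  toFun x := (σ.toFun x).subst τ.toFun
  finite_dom := by
    refine (σ.finite_dom.union τ.finite_dom).subset fun x hx => ?_
    by_contra h
    simp only [Set.mem_union, Set.mem_ofPred_eq, not_or, not_not] at h
    exact hx (by rw [h.1, Term.subst, h.2])

theorem InstLE.trans {E : Set (Term F × Term F)} {X : Set ℕ} {σ θ ρ : Subst F}
    (h₁ : InstLE E X σ θ) (h₂ : InstLE E X θ ρ) : InstLE E X σ ρ := by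
  obtain ⟨l, hl⟩ := h₁
  obtain ⟨m, hm⟩ := h₂
  refine ⟨m.comp l, fun x hx => ?_⟩
  have h := ((hl x hx).subst m.toFun).trans (hm x hx)
  rwa [Term.subst_subst] at h

theorem InstLE.mono {E : Set (Term F × Term F)} {X Y : Set ℕ} {σ θ : Subst F}
    (hXY : X ⊆ Y) (h : InstLE E Y σ θ) : InstLE E X σ θ := by
  obtain ⟨l, hl⟩ := h
  exact ⟨l, fun x hx => hl x (hXY hx)⟩

theorem CompleteSet.mono {E Γ : Set (Term F × Term F)} {X Y : Set ℕ} {S : Set (Subst F)}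
    (hXY : X ⊆ Y) (h : CompleteSet E Γ Y S) : CompleteSet E Γ X S := by
  refine ⟨h.1, fun θ hθ => ?_⟩
  obtain ⟨σ, hσ, hle⟩ := h.2 θ hθ
  exact ⟨σ, hσ, hle.mono hXY⟩

theorem CompleteSet.diff_singleton {E Γ : Set (Term F × Term F)} {X : Set ℕ}
    {S : Set (Subst F)} (h : CompleteSet E Γ X S) {σ θ : Subst F} (hσ : σ ∈ S)
    (hne : σ ≠ θ) (hle : InstLE E X σ θ) : CompleteSet E Γ X (S \ {θ}) := by
  refine ⟨fun ρ hρ => h.1 ρ hρ.1, fun ρ hρ => ?_⟩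
  obtain ⟨μ, hμ, hμρ⟩ := h.2 ρ hρ
  by_cases hμθ : μ = θ
  · subst hμθ
    exact ⟨σ, ⟨hσ, hne⟩, hle.trans hμρ⟩
  · exact ⟨μ, ⟨hμ, hμθ⟩, hμρ⟩

/-- Every finite complete set of unifiers contains a minimal complete one. -/
theorem CompleteSet.exists_minimalComplete {E Γ : Set (Term F × Term F)} {X : Set ℕ}
    {S : Set (Subst F)} (hS : S.Finite) (h : CompleteSet E Γ X S) :
    ∃ T ⊆ S, MinimalComplete E Γ X T := by
  have hfin : {T | T ⊆ S ∧ CompleteSet E Γ X T}.Finite :=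
    hS.finite_subsets.subset fun _ hT => hT.1
  obtain ⟨T, ⟨hTS, hT⟩, hmin⟩ := hfin.exists_minimal ⟨S, subset_rfl, h⟩
  refine ⟨T, hTS, hT, fun σ hσ θ hθ hne hle => ?_⟩
  exact (hmin ⟨Set.sdiff_subset.trans hTS, hT.diff_singleton hσ hne hle⟩
    Set.sdiff_subset hθ).2 rfl

theorem TypeUnitary.mono {E Γ : Set (Term F × Term F)} {X Y : Set ℕ}
    (hXY : X ⊆ Y) (h : TypeUnitary E Γ Y) : TypeUnitary E Γ X := by
  obtain ⟨σ, hσ⟩ := h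
  refine ⟨σ, hσ.1.mono hXY, ?_⟩
  rintro _ rfl _ rfl hne
  exact absurd rfl hne

theorem CompleteSet.typeUnitary_or_typeFinitary {E Γ : Set (Term F × Term F)} {X : Set ℕ}
    {S : Set (Subst F)} (hS : S.Finite) (h : CompleteSet E Γ X S) (hΓ : Solvable E Γ) :
    TypeUnitary E Γ X ∨ TypeFinitary E Γ X := by
  obtain ⟨T, hTS, hT⟩ := h.exists_minimalComplete hS
  have hfin := hS.subset hTS
  obtain ⟨θ, hθ⟩ := hΓ
  obtain ⟨σ, hσ, -⟩ := hT.1.2 θ hθ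
  have hpos : 0 < T.ncard := (Set.ncard_pos hfin).2 ⟨σ, hσ⟩
  rcases Nat.eq_or_lt_of_le hpos with h1 | h1
  · obtain ⟨τ, rfl⟩ := Set.ncard_eq_one.1 h1.symm
    exact .inl ⟨τ, hT⟩
  · exact .inr ⟨T, hT, hfin, h1⟩

/-- Theorem `typ:no:worse:thm`: if a non-trivial theory `E`
has unrestricted unification type unitary, then its restricted type is unitary;
if its unrestricted type is finitary, then its restricted type is finitary or
unitary. -/
theorem stmt1 {F : ℕ → Type} (E : Set (Term F × Term F)) (hE : NonTrivial E) :
    (TheoryUnrUnitary E → TheoryResUnitary E) ∧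
    (TheoryUnrFinitary E → TheoryResFinitary E ∨ TheoryResUnitary E) := by
  refine ⟨fun h Γ hfin hsol => (h Γ hfin hsol).mono (Set.subset_univ _), fun h => ?_⟩
  have key : ∀ Γ : Set (Term F × Term F), Γ.Finite → Solvable E Γ →
      TypeUnitary E Γ (VarsP Γ) ∨ TypeFinitary E Γ (VarsP Γ) := by
    intro Γ hfin hsol
    rcases h.1 Γ hfin hsol with h1 | ⟨S, hS, hSfin, -⟩
    · exact .inl (h1.mono (Set.subset_univ _))
    · exact (hS.1.mono (Set.subset_univ _)).typeUnitary_or_typeFinitary hSfin hsol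
  by_cases hex : ∃ Γ : Set (Term F × Term F),
      Γ.Finite ∧ Solvable E Γ ∧ TypeFinitary E Γ (VarsP Γ)
  · exact .inl ⟨key, hex⟩
  · exact .inr fun Γ hfin hsol =>
      (key Γ hfin hsol).resolve_right fun hΓ => hex ⟨Γ, hfin, hsol, hΓ⟩
end UnifFW
end

section
/- Let E be a non-trivial regular equational theory and Γ = { s ≈_E^? t } a NUOF E-unification problem with X := Var(s) ∪ Var(t), witnessed by the ≤_E^V-minimal unifier σ ∈ C_E(Γ) with VRan(σ) \ X ≠ ∅. Fix x₀ ∈ VRan(σ) \ X and for z ∈ V let σ_z := σ ∘ τ_{x₀,z}, where τ_{x₀,z} is the substitution swapping x₀ and z (i.e., σ_z(x) = σ(τ_{x₀,z}(x)) for all x ∈ V). Then: (1) for each z ∈ V \ X, σ_z is a ≤_E^V-minimal E-unifier of Γ; and (2) for any two distinct variables z, z' ∈ V \ (Dom(σ) ∪ VRan(σ)), the substitutions σ_z and σ_{z'} are incomparable w.r.t. ≤_E^V. -/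
namespace UnifFW

variable {F : ℕ → Type}

/-- The substitution `σ ∘ τ_{a,b}` obtained by precomposing `σ` with the
substitution swapping the variables `a` and `b`. -/
def Subst.precompSwap (σ : Subst F) (a b : ℕ) : Subst F where
  toFun x := σ.toFun (Equiv.swap a b x)
  finite_dom := by
    apply Set.Finite.subset (σ.finite_dom.union (Set.finite_singleton a |>.insert b))
    intro x hx
    by_cases hxa : x = a
    · exact Or.inr (by simp [hxa])
    · by_cases hxb : x = b
      · exact Or.inr (by simp [hxb])
      · left
        simpa [Equiv.swap_apply_of_ne_of_ne hxa hxb] using hx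

theorem Term.mem_vars_subst {σ : ℕ → Term F} {t : Term F} {z : ℕ} :
    z ∈ (t.subst σ).vars ↔ ∃ y ∈ t.vars, z ∈ (σ y).vars := by
  induction t with
  | var x => simp [Term.subst, Term.vars]
  | app n f ts ih =>
    simp only [Term.subst, Term.vars, Set.mem_iUnion, ih]
    exact ⟨fun ⟨i, y, hy, hz⟩ => ⟨y, ⟨i, hy⟩, hz⟩, fun ⟨y, ⟨i, hy⟩, hz⟩ => ⟨i, y, hy, hz⟩⟩

theorem Term.subst_congr {σ θ : ℕ → Term F} {t : Term F} (h : ∀ x ∈ t.vars, σ x = θ x) :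
    t.subst σ = t.subst θ := by
  induction t with
  | var x => exact h x rfl
  | app n f ts ih =>
    simp only [Term.subst]
    congr 1
    funext i
    exact ih i fun x hx => h x (Set.mem_iUnion.2 ⟨i, hx⟩)

/-- In a regular theory, equal terms have the same variables. -/
theorem EqE.vars_eq {E : Set (Term F × Term F)} (hreg : Regular E) {s t : Term F}
    (h : EqE E s t) : s.vars = t.vars := by
  induction h with
  | ax σ h =>
    ext z
    rw [Term.mem_vars_subst, Term.mem_vars_subst, hreg _ h]
  | refl => rfl
  | symm _ ih => exact ih.symm
  | trans _ _ ih₁ ih₂ => exact ih₁.trans ih₂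
  | congr f _ ih => simp only [Term.vars, ih]

theorem Subst.toFun_eq_var {σ : Subst F} {x : ℕ} (hx : x ∉ σ.Dom) : σ.toFun x = .var x :=
  not_not.1 hx

theorem Subst.mem_VRan {σ : Subst F} {x y : ℕ} (hx : x ∈ σ.Dom) (hy : y ∈ (σ.toFun x).vars) :
    y ∈ σ.VRan :=
  Set.mem_biUnion hx hy

theorem Unifier.precompSwap {E : Set (Term F × Term F)} {s t : Term F} {σ : Subst F} {a b : ℕ}
    (ha : a ∉ s.vars ∪ t.vars) (hb : b ∉ s.vars ∪ t.vars) (h : Unifier E {(s, t)} σ) :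
    Unifier E {(s, t)} (σ.precompSwap a b) := by
  have key : ∀ x ∈ s.vars ∪ t.vars, (σ.precompSwap a b).toFun x = σ.toFun x := by
    intro x hx
    have hxa : x ≠ a := fun h => ha (h ▸ hx)
    have hxb : x ≠ b := fun h => hb (h ▸ hx)
    simp [Subst.precompSwap, Equiv.swap_apply_of_ne_of_ne hxa hxb]
  rintro p rfl
  have := h _ rfl
  rwa [← Term.subst_congr fun x hx => key x (Or.inl hx),
    ← Term.subst_congr fun x hx => key x (Or.inr hx)] at this

/-- Precomposition with a swap of variables outside the problem preserves minimality. -/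
theorem MinUnifier.precompSwap {E : Set (Term F × Term F)} {s t : Term F} {σ : Subst F} {a b : ℕ}
    (ha : a ∉ s.vars ∪ t.vars) (hb : b ∉ s.vars ∪ t.vars)
    (h : MinUnifier E {(s, t)} Set.univ σ) :
    MinUnifier E {(s, t)} Set.univ (σ.precompSwap a b) := by
  refine ⟨h.1.precompSwap ha hb, fun θ hθ ⟨lam, hlam⟩ => ?_⟩
  obtain ⟨mu, hmu⟩ := h.2 (θ.precompSwap a b) (hθ.precompSwap ha hb)
    ⟨lam, fun x _ => by simpa [Subst.precompSwap] using hlam (Equiv.swap a b x) trivial⟩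
  exact ⟨mu, fun x _ => by simpa [Subst.precompSwap] using hmu (Equiv.swap a b x) trivial⟩

theorem not_instLE_precompSwap {E : Set (Term F × Term F)} (hreg : Regular E) {σ : Subst F}
    (hC : ∀ y ∈ σ.VRan, ∃ x x' : ℕ, x ≠ x' ∧ y ∈ (σ.toFun x).vars ∩ (σ.toFun x').vars)
    {x₀ z z' : ℕ} (hx₀ : x₀ ∈ σ.VRan) (hz : z ∉ σ.Dom ∪ σ.VRan) (hz' : z' ∉ σ.Dom ∪ σ.VRan)
    (hne : z ≠ z') :
    ¬ InstLE E Set.univ (σ.precompSwap x₀ z) (σ.precompSwap x₀ z') := by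
  rintro ⟨lam, hlam⟩
  simp only [Set.mem_union, not_or] at hz hz'
  have hzx₀ : z ≠ x₀ := fun h => hz.2 (h ▸ hx₀)
  have hσz := Subst.toFun_eq_var hz.1
  have hσz' := Subst.toFun_eq_var hz'.1
  have h₀ := (hlam z trivial).vars_eq hreg
  simp only [Subst.precompSwap, Equiv.swap_apply_right,
    Equiv.swap_apply_of_ne_of_ne hzx₀ hne, hσz] at h₀
  obtain ⟨y, hy, hzy⟩ := Term.mem_vars_subst.1 (h₀.symm.subset (Set.mem_singleton z))
  have hyR : y ∈ σ.VRan := by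
    by_cases hd : x₀ ∈ σ.Dom
    · exact Subst.mem_VRan hd hy
    · rw [Subst.toFun_eq_var hd] at hy
      obtain rfl : y = x₀ := hy
      exact hx₀
  obtain ⟨x, hxx₀, hyx⟩ : ∃ x, x ≠ x₀ ∧ y ∈ (σ.toFun x).vars := by
    obtain ⟨x, x', hxx', hx, hx'⟩ := hC y hyR
    by_cases h : x = x₀
    · exact ⟨x', fun h' => hxx' (h.trans h'.symm), hx'⟩
    · exact ⟨x, h, hx⟩
  have hxz : x ≠ z := by
    rintro rfl
    rw [hσz] at hyx
    obtain rfl : y = x := hyx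
    exact hz.2 hyR
  have hxz' : x ≠ z' := by
    rintro rfl
    rw [hσz'] at hyx
    obtain rfl : y = x := hyx
    exact hz'.2 hyR
  have h₁ := (hlam x trivial).vars_eq hreg
  simp only [Subst.precompSwap, Equiv.swap_apply_of_ne_of_ne hxx₀ hxz,
    Equiv.swap_apply_of_ne_of_ne hxx₀ hxz'] at h₁
  have hzx : z ∈ (σ.toFun x).vars := h₁ ▸ Term.mem_vars_subst.2 ⟨y, hyx, hzy⟩
  by_cases hd : x ∈ σ.Dom
  · exact hz.2 (Subst.mem_VRan hd hzx)
  · rw [Subst.toFun_eq_var hd] at hzx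
    exact hxz hzx.symm

/-- Lemma `NUOF:lem`: let `E` be a non-trivial regular
theory, `Γ = {s ≈ t}` with `Var(s) ∩ Var(t) = ∅` (so `X = Var(s) ∪ Var(t)`),
`σ` a `≤_E^V`-minimal unifier of `Γ` belonging to `C_E(Γ)` that uses a fresh
variable `x₀ ∈ VRan(σ) \ X`, and `σ_z := σ ∘ τ_{x₀,z}`. Then (1) for every
`z ∈ V \ X`, `σ_z` is a `≤_E^V`-minimal `E`-unifier of `Γ`, and (2) for
distinct `z, z' ∈ V \ (Dom(σ) ∪ VRan(σ))`, `σ_z` and `σ_{z'}` are incomparable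
w.r.t. `≤_E^V`. -/
theorem stmt6 {F : ℕ → Type} (E : Set (Term F × Term F)) (hE : NonTrivial E)
    (hreg : Regular E) (s t : Term F) (hd : s.vars ∩ t.vars = ∅)
    (σ : Subst F) (hmin : MinUnifier E {(s, t)} Set.univ σ)
    (hC : σ ∈ CSet E {(s, t)})
    (x₀ : ℕ) (hx₀ : x₀ ∈ σ.VRan \ (s.vars ∪ t.vars)) :
    (∀ z : ℕ, z ∉ s.vars ∪ t.vars →
      MinUnifier E {(s, t)} Set.univ (σ.precompSwap x₀ z)) ∧
    (∀ z z' : ℕ, z ∉ σ.Dom ∪ σ.VRan → z' ∉ σ.Dom ∪ σ.VRan → z ≠ z' →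
      ¬ InstLE E Set.univ (σ.precompSwap x₀ z) (σ.precompSwap x₀ z') ∧
      ¬ InstLE E Set.univ (σ.precompSwap x₀ z') (σ.precompSwap x₀ z)) := by
  exact ⟨fun z hz => hmin.precompSwap hx₀.2 hz, fun z z' hz hz' hne =>
    ⟨not_instLE_precompSwap hreg hC.2 hx₀.1 hz hz' hne,
      not_instLE_precompSwap hreg hC.2 hx₀.1 hz' hz hne.symm⟩⟩

end UnifFW
end
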